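/- Suppose the bitstrings l₁, …, lₙ are pairwise distinct and lₙ is the all-zeros bitstring. Suppose g₁, …, g_{k′} with k′ ≤ 2n − 1 are STM moves such that in the configuration (g_{k′} ⋯ g₁ · t)(C₀) every face is monochromatic, i.e. for each direction d the map sending each surface slot p with direction d to the direction component of (g_{k′} ⋯ g₁ · t)⁻¹(p) is constant. Then there is a bijection σ of {1, …, n} such that the Hamming distance between l_{σ(p)} and l_{σ(p+1)} equals 1 for every 1 ≤ p ≤ n − 1. -/

import Mathlib

namespace RC

/-- The six signed coordinate directions. -/
inductive Dir : Type
  | xp | xn | yp | yn | zp | zn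
  deriving DecidableEq

/-- Nonzero slice coordinates of absolute value at most `h`. -/
def I (h : ℕ) : Type := {i : ℤ // i ≠ 0 ∧ |i| ≤ (h : ℤ)}

instance (h : ℕ) : DecidableEq (I h) :=
  inferInstanceAs (DecidableEq {i : ℤ // i ≠ 0 ∧ |i| ≤ (h : ℤ)})

instance (h : ℕ) : Neg (I h) :=
  ⟨fun i => ⟨-i.1, neg_ne_zero.mpr i.2.1, by rw [abs_neg]; exact i.2.2⟩⟩

@[simp] theorem I.neg_neg {h : ℕ} (i : I h) : -(-i) = i :=
  Subtype.ext (by show -(-i.1) = i.1; exact _root_.neg_neg i.1)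

/-- Sticker slots of the cube: a cubie position together with a face direction. -/
abbrev S (h : ℕ) : Type := (I h × I h × I h) × Dir

/-- Rotation of directions by a clockwise `x` turn: fixes `±x`,
`+y ↦ −z ↦ −y ↦ +z ↦ +y`. -/
def rotX : Dir → Dir
  | .xp => .xp | .xn => .xn | .yp => .zn | .zn => .yn | .yn => .zp | .zp => .yp

def rotXi : Dir → Dir
  | .xp => .xp | .xn => .xn | .zn => .yp | .yn => .zn | .zp => .yn | .yp => .zp

/-- Rotation of directions by a clockwise `y` turn: fixes `±y`,
`+z ↦ −x ↦ −z ↦ +x ↦ +z`. -/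
def rotY : Dir → Dir
  | .yp => .yp | .yn => .yn | .zp => .xn | .xn => .zn | .zn => .xp | .xp => .zp

def rotYi : Dir → Dir
  | .yp => .yp | .yn => .yn | .xn => .zp | .zn => .xn | .xp => .zn | .zp => .xp

/-- Rotation of directions by a clockwise `z` turn: fixes `±z`,
`+x ↦ −y ↦ −x ↦ +y ↦ +x`. -/
def rotZ : Dir → Dir
  | .zp => .zp | .zn => .zn | .xp => .yn | .yn => .xn | .xn => .yp | .yp => .xp

def rotZi : Dir → Dir
  | .zp => .zp | .zn => .zn | .yn => .xp | .xn => .yn | .yp => .xn | .xp => .yp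

@[simp] theorem rotXi_rotX (d : Dir) : rotXi (rotX d) = d := by cases d <;> rfl
@[simp] theorem rotX_rotXi (d : Dir) : rotX (rotXi d) = d := by cases d <;> rfl
@[simp] theorem rotYi_rotY (d : Dir) : rotYi (rotY d) = d := by cases d <;> rfl
@[simp] theorem rotY_rotYi (d : Dir) : rotY (rotYi d) = d := by cases d <;> rfl
@[simp] theorem rotZi_rotZ (d : Dir) : rotZi (rotZ d) = d := by cases d <;> rfl
@[simp] theorem rotZ_rotZi (d : Dir) : rotZ (rotZi d) = d := by cases d <;> rfl

/-- Clockwise quarter turn of the `x = v` slice (as seen from positive `x`). -/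
def X {h : ℕ} (v : I h) : Equiv.Perm (S h) where
  toFun s := if s.1.1 = v then ((s.1.1, s.1.2.2, -s.1.2.1), rotX s.2) else s
  invFun s := if s.1.1 = v then ((s.1.1, -s.1.2.2, s.1.2.1), rotXi s.2) else s
  left_inv := by
    rintro ⟨⟨x, y, z⟩, d⟩
    by_cases hx : x = v <;> simp [hx]
  right_inv := by
    rintro ⟨⟨x, y, z⟩, d⟩
    by_cases hx : x = v <;> simp [hx]

/-- Clockwise quarter turn of the `y = v` slice (as seen from positive `y`). -/
def Y {h : ℕ} (v : I h) : Equiv.Perm (S h) where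
  toFun s := if s.1.2.1 = v then ((-s.1.2.2, s.1.2.1, s.1.1), rotY s.2) else s
  invFun s := if s.1.2.1 = v then ((s.1.2.2, s.1.2.1, -s.1.1), rotYi s.2) else s
  left_inv := by
    rintro ⟨⟨x, y, z⟩, d⟩
    by_cases hy : y = v <;> simp [hy]
  right_inv := by
    rintro ⟨⟨x, y, z⟩, d⟩
    by_cases hy : y = v <;> simp [hy]

/-- Clockwise quarter turn of the `z = v` slice (as seen from positive `z`). -/
def Z {h : ℕ} (v : I h) : Equiv.Perm (S h) where
  toFun s := if s.1.2.2 = v then ((s.1.2.1, -s.1.1, s.1.2.2), rotZ s.2) else s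
  invFun s := if s.1.2.2 = v then ((-s.1.2.1, s.1.1, s.1.2.2), rotZi s.2) else s
  left_inv := by
    rintro ⟨⟨x, y, z⟩, d⟩
    by_cases hz : z = v <;> simp [hz]
  right_inv := by
    rintro ⟨⟨x, y, z⟩, d⟩
    by_cases hz : z = v <;> simp [hz]

/-- The side-length parameter: `h = m + 3n`. -/
abbrev hC (n m : ℕ) : ℕ := m + 3 * n

def bit {m : ℕ} (w : Fin m → Bool) (c : ℤ) : Bool :=
  if hc : 1 ≤ c ∧ c ≤ (m : ℤ) then w ⟨(c - 1).toNat, by omega⟩ else false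

/-- The `x`-slice index corresponding to bit position `j`. -/
def colIdx {n m : ℕ} (j : Fin m) : I (hC n m) :=
  ⟨((j : ℕ) : ℤ) + 1, by
    have hj : (j : ℕ) < m := j.isLt
    constructor
    · omega
    · rw [abs_of_nonneg (by omega)]; push_cast; omega⟩

/-- The `z`-slice index `m + i` corresponding to row `i`. -/
def zIdx {n m : ℕ} (i : Fin n) : I (hC n m) :=
  ⟨(m : ℤ) + ((i : ℕ) : ℤ) + 1, by
    have hi : (i : ℕ) < n := i.isLt
    constructor
    · omega
    · rw [abs_of_nonneg (by omega)]; push_cast; omega⟩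

/-- The face coordinate `h`. -/
def topI {n m : ℕ} (H : 0 < m + 3 * n) : I (hC n m) :=
  ⟨(m : ℤ) + 3 * (n : ℤ), by
    constructor
    · omega
    · rw [abs_of_nonneg (by omega)]; push_cast; omega⟩

/-- `aᵢ := (X 1)^{lᵢ(1)} ⋯ (X m)^{lᵢ(m)}`. -/
def a {n m : ℕ} (l : Fin n → Fin m → Bool) (i : Fin n) : Equiv.Perm (S (hC n m)) :=
  ((List.finRange m).map (fun j => X (colIdx (n := n) j) ^ (if l i j then 1 else 0))).prod

/-- `bᵢ := aᵢ⁻¹ · (Z (m+i)) · aᵢ`. -/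
def b {n m : ℕ} (l : Fin n → Fin m → Bool) (i : Fin n) : Equiv.Perm (S (hC n m)) :=
  (a l i)⁻¹ * Z (zIdx (m := m) i) * a l i

/-- `t := a₁ · b₁ · b₂ ⋯ bₙ`. -/
def t {n m : ℕ} (hn : 0 < n) (l : Fin n → Fin m → Bool) : Equiv.Perm (S (hC n m)) :=
  a l ⟨0, hn⟩ * ((List.finRange n).map (b l)).prod

/-- A slot is a surface slot if its cubie is on the face its direction points to. -/
def IsSurface {h : ℕ} (s : S h) : Prop :=
  match s.2 with
  | .xp => s.1.1.1 = (h : ℤ)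
  | .xn => s.1.1.1 = -(h : ℤ)
  | .yp => s.1.2.1.1 = (h : ℤ)
  | .yn => s.1.2.1.1 = -(h : ℤ)
  | .zp => s.1.2.2.1 = (h : ℤ)
  | .zn => s.1.2.2.1 = -(h : ℤ)

/-- An STM move: a nontrivial rotation of a single slice. -/
def IsSTM {h : ℕ} (g : Equiv.Perm (S h)) : Prop :=
  ∃ (v : I h) (e : ℕ), (e = 1 ∨ e = 2 ∨ e = 3) ∧
    (g = X v ^ e ∨ g = Y v ^ e ∨ g = Z v ^ e)


/-- Universal statements about directions are checked one direction at a time. -/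
instance Dir.decidableForall (p : Dir → Prop) [DecidablePred p] : Decidable (∀ d, p d) :=
  decidable_of_iff (p .xp ∧ p .xn ∧ p .yp ∧ p .yn ∧ p .zp ∧ p .zn)
    ⟨fun ⟨h₁, h₂, h₃, h₄, h₅, h₆⟩ d => by cases d <;> assumption,
      fun h => ⟨h _, h _, h _, h _, h _, h _⟩⟩

/-- The coordinate axis of a direction. -/
def Dir.axis : Dir → ℕ
  | .xp => 0 | .xn => 0 | .yp => 1 | .yn => 1 | .zp => 2 | .zn => 2

/-- The clockwise quarter turn about the axis of a direction. -/
def quarter : Dir → Dir → Dir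
  | .xp => rotX | .xn => rotX | .yp => rotY | .yn => rotY | .zp => rotZ | .zn => rotZ

/-- A sticker whose cubie is at `α • u + β • v + h • w` and which faces `w`, given as
`(u, v, w)`; the distances `α` and `β` are kept separately. -/
abbrev Sticker : Type := Dir × Dir × Dir

/-- The three directions of the sticker lie on different axes. -/
def Proper (q : Sticker) : Prop :=
  q.1.axis ≠ q.2.1.axis ∧ q.1.axis ≠ q.2.2.axis ∧ q.2.1.axis ≠ q.2.2.axis

instance : DecidablePred Proper := fun q => by unfold Proper; infer_instance

/-- Rotate a sticker by a quarter turn about the axis of `δ`. -/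
def turn (δ : Dir) (q : Sticker) : Sticker :=
  (quarter δ q.1, quarter δ q.2.1, quarter δ q.2.2)

/-- Quarter turn of the slice at distance `α` in direction `δ`. -/
def turnA (δ : Dir) (q : Sticker) : Sticker := if q.1 = δ then turn δ q else q

/-- Quarter turn of the slice at distance `β` in direction `δ`. -/
def turnB (δ : Dir) (q : Sticker) : Sticker := if q.2.1 = δ then turn δ q else q

/-- Quarter turn of the face in direction `δ`. -/
def turnC (δ : Dir) (q : Sticker) : Sticker := if q.2.2 = δ then turn δ q else q

/-- Turn every slice at distance `α` by the prescribed number of quarter turns. -/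
def turnsA (p : Dir → ℕ) (q : Sticker) : Sticker := (turn q.1)^[p q.1] q

/-- The action of `(Xⁱ)⁻¹ Z Xⁱ`, with `X` at distance `α` and `Z` at distance `β`. -/
def conjZ (i : ℕ) (q : Sticker) : Sticker :=
  (turnA .xp)^[3 * i] (turnB .zp ((turnA .xp)^[i] q))

theorem forall_proper {P : Sticker → Prop} :
    (∀ q, Proper q → P q) ↔ ∀ a b c, Proper (a, b, c) → P (a, b, c) :=
  ⟨fun h a b c => h (a, b, c), fun h q => h q.1 q.2.1 q.2.2⟩

theorem turnB_eq_inverse (δ : Dir) (e : Fin 4) (he : e ≠ 0)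
    (H : ∀ q, Proper q → ((turnB δ)^[e] q).2.2 = q.2.2 ∨
      ((turnB δ)^[e] q).2.2 = rotZi q.2.2) :
    (δ = .zp ∨ δ = .zn) ∧ e = 3 := by
  rw [forall_proper] at H
  revert δ e; decide

theorem turnC_commutes (δ δ' : Dir) (hδ : δ = .zp ∨ δ = .zn) (hδ' : δ' = .zp ∨ δ' = .zn)
    (ε : Dir) (e : Fin 4)
    (H : ∀ q, Proper q → ((turnB δ)^[3] q).2.2 = ((turnB δ')^[3] ((turnC ε)^[e] q)).2.2) :
    ∀ q, Proper q → (turnB δ')^[3] ((turnC ε)^[e] q) = (turnC ε)^[e] ((turnB δ)^[3] q) := by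
  rw [forall_proper] at H ⊢
  revert ε e
  rcases hδ with rfl | rfl <;> rcases hδ' with rfl | rfl <;> decide

theorem conjZ_bit (i i' : Fin 2)
    (H : ∀ q r, Proper q → Proper r → conjZ i q = conjZ i' r → q.2.2 = r.2.2) :
    i = i' := by
  have h₁ := H (.xp, .zp, .yp) (.xp, .yn, .zp)
  have h₂ := H (.xp, .yn, .zp) (.xp, .zp, .yp)
  clear H
  revert i i'; decide

theorem turnB_pair (δ δ' : Dir) (e e' : Fin 4) (he : e ≠ 0) (he' : e' ≠ 0)
    (H : ∀ q, Proper q → ((turnB δ')^[e'] ((turnB δ)^[e] (turnB .zp q))).2.2 = q.2.2) :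
    δ = .zp ∧ δ' = .zp ∧ (e : ℕ) + e' = 3 := by
  rw [forall_proper] at H
  revert δ δ' e e'; decide

theorem turnB_single (δ : Dir) (hδ : δ = .zp ∨ δ = .zn)
    (H : ∀ q, Proper q → ((turnB δ)^[3] (turnB .zp q)).2.2 = q.2.2) :
    δ = .zp := by
  rw [forall_proper] at H
  revert δ; decide

theorem turn_four (δ : Dir) (q : Sticker) : (turn δ)^[4] q = q := by
  obtain ⟨a, b, c⟩ := q
  revert δ a b c; decide

theorem turn_mod (δ : Dir) (n : ℕ) (q : Sticker) : (turn δ)^[n % 4] q = (turn δ)^[n] q :=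
  Function.IsPeriodicPt.iterate_mod_apply (turn_four δ q) n

theorem turn_iterate_fst (δ : Dir) (n : ℕ) (q : Sticker) (hq : q.1 = δ) :
    ((turn δ)^[n] q).1 = δ := by
  induction n with
  | zero => exact hq
  | succ n ih =>
    rw [Function.iterate_succ_apply']
    generalize (turn δ)^[n] q = r at ih
    subst ih
    obtain ⟨a, b, c⟩ := r
    cases a <;> rfl

theorem turnA_iterate (δ : Dir) (n : ℕ) (q : Sticker) :
    (turnA δ)^[n] q = if q.1 = δ then (turn δ)^[n] q else q := by
  induction n with
  | zero => simp
  | succ n ih =>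
    rw [Function.iterate_succ_apply', ih]
    split_ifs with h
    · rw [Function.iterate_succ_apply', turnA, if_pos (turn_iterate_fst δ n q h)]
    · rw [turnA, if_neg h]

theorem turnsA_fst (p : Dir → ℕ) (q : Sticker) : (turnsA p q).1 = q.1 :=
  turn_iterate_fst _ _ q rfl

theorem turnsA_add (p r : Dir → ℕ) (q : Sticker) :
    turnsA p (turnsA r q) = turnsA (fun δ => p δ + r δ) q := by
  rw [turnsA, turnsA_fst, turnsA, turnsA, ← Function.iterate_add_apply]

theorem turnsA_congr {p r : Dir → ℕ} (q : Sticker) (h : p q.1 ≡ r q.1 [MOD 4]) :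
    turnsA p q = turnsA r q := by
  rw [turnsA, turnsA, ← turn_mod, h, turn_mod]

theorem turnA_eq_turnsA (δ : Dir) (n : ℕ) (q : Sticker) :
    (turnA δ)^[n] q = turnsA (fun d => if d = δ then n else 0) q := by
  rw [turnA_iterate, turnsA]
  split_ifs with h
  · rw [h]
  · rfl

/-- The first direction of the sticker is not along the `z` axis. -/
def OffZ (q : Sticker) : Prop := q.1 ≠ .zp ∧ q.1 ≠ .zn

instance : DecidablePred OffZ := fun q => by unfold OffZ; infer_instance

theorem OffZ.turnsA {q : Sticker} (h : OffZ q) (p : Dir → ℕ) : OffZ (turnsA p q) := by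
  simpa [OffZ, turnsA_fst] using h

theorem OffZ.turnB {q : Sticker} (h : OffZ q) : OffZ (turnB .zp q) := by
  obtain ⟨a, b, c⟩ := q
  revert a b c; decide

theorem OffZ.turnB_iterate {q : Sticker} (h : OffZ q) (n : ℕ) :
    OffZ ((RC.turnB .zp)^[n] q) := by
  induction n with
  | zero => exact h
  | succ n ih => rw [Function.iterate_succ_apply']; exact ih.turnB

theorem OffZ.conjZ {q : Sticker} (h : OffZ q) (i : ℕ) : OffZ (conjZ i q) := by
  rw [RC.conjZ, turnA_eq_turnsA, turnA_eq_turnsA]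
  exact (h.turnsA _).turnB.turnsA _

theorem turnsA_eq_zero (p : Dir → ℕ) (H : ∀ q, Proper q → (turnsA p q).2.2 = q.2.2) (δ : Dir) :
    p δ ≡ 0 [MOD 4] := by
  have key : ∀ δ : Dir, ∀ n : Fin 4, (∀ b c, Proper (δ, b, c) →
      ((turn δ)^[n] (δ, b, c)).2.2 = c) → n = 0 := by decide
  have := key δ ⟨p δ % 4, Nat.mod_lt _ (by norm_num)⟩ fun b c h => by
    simpa only [turn_mod, turnsA] using H _ h
  simpa [Nat.ModEq, Fin.ext_iff] using this

/-- The exponents on the four slices which are not perpendicular to the `z` axis. -/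
def sideExponents (w x y z : Fin 4) : Dir → ℕ
  | .xp => w | .xn => x | .yp => y | .yn => z | .zp => 0 | .zn => 0

theorem sideExponents_eq (w x y z : Fin 4) (i : Fin 2)
    (H : ∀ a b c, Proper (a, b, c) → OffZ (a, b, c) →
      (turnsA (fun δ => 3 * sideExponents w x y z δ) ((turnB .zp)^[3]
        (turnsA (sideExponents w x y z) (conjZ i (a, b, c))))).2.2 = c) :
    (w : ℕ) = i ∧ x = 0 ∧ y = 0 ∧ z = 0 := by
  revert w x y z i; decide

theorem exponents_eq (p : Dir → ℕ) (i : Fin 2)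
    (H : ∀ q, Proper q → (turnsA (fun δ => 3 * p δ) ((turnB .zp)^[3]
        (turnsA p (conjZ i q)))).2.2 = q.2.2) :
    p .xp ≡ i [MOD 4] ∧ p .xn ≡ 0 [MOD 4] ∧ p .yp ≡ 0 [MOD 4] ∧ p .yn ≡ 0 [MOD 4] := by
  have lt : ∀ δ, p δ % 4 < 4 := fun δ => Nat.mod_lt _ (by norm_num)
  set r := sideExponents ⟨_, lt .xp⟩ ⟨_, lt .xn⟩ ⟨_, lt .yp⟩ ⟨_, lt .yn⟩ with hr
  have cong : ∀ q, OffZ q → p q.1 ≡ r q.1 [MOD 4] := by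
    rintro ⟨a, b, c⟩ ⟨h₁, h₂⟩
    cases a <;> simp_all [sideExponents, Nat.ModEq]
  obtain ⟨h₁, h₂, h₃, h₄⟩ := sideExponents_eq ⟨_, lt .xp⟩ ⟨_, lt .xn⟩ ⟨_, lt .yp⟩ ⟨_, lt .yn⟩ i
      fun a b c hq hz => by
    have h := H _ hq
    have hz' := hz.conjZ (i := i)
    rw [turnsA_congr _ (cong _ hz'), turnsA_congr (r := fun δ => 3 * r δ) _
      ((cong _ ((hz'.turnsA r).turnB_iterate 3)).mul_left 3)] at h
    exact h
  have hi := i.2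
  refine ⟨?_, ?_, ?_, ?_⟩
  · show p .xp % 4 = (i : ℕ) % 4
    rw [Nat.mod_eq_of_lt (by omega : (i : ℕ) < 4)]; exact h₁
  · exact congrArg Fin.val h₂
  · exact congrArg Fin.val h₃
  · exact congrArg Fin.val h₄

theorem turnsA_eq_turnA {p : Dir → ℕ} {n : ℕ} (h₁ : p .xp ≡ n [MOD 4])
    (h₂ : p .xn ≡ 0 [MOD 4]) (h₃ : p .yp ≡ 0 [MOD 4]) (h₄ : p .yn ≡ 0 [MOD 4])
    {q : Sticker} (hq : OffZ q) : turnsA p q = (turnA .xp)^[n] q := by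
  rw [turnA_eq_turnsA]
  apply turnsA_congr
  obtain ⟨a, b, c⟩ := q
  obtain ⟨h, h'⟩ := hq
  cases a <;> simp_all

theorem two_turns_eq (e : Fin 4) (he : e = 1 ∨ e = 2) (c₁ c₂ i : Fin 2)
    (H : ∀ q, Proper q → OffZ q → ((turnA .xp)^[3 * c₂] ((turnB .zp)^[3 - e]
      ((turnA .xp)^[c₂ + 3 * c₁] ((turnB .zp)^[e] ((turnA .xp)^[c₁] (conjZ i q)))))).2.2
        = q.2.2) :
    c₁ = i ∧ c₂ = i := by
  rw [forall_proper] at H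
  revert e c₁ c₂ i; decide

/-- The component of the second direction along the first one. -/
def coeff (δ d : Dir) : ℤ := if d = δ then 1 else if d.axis = δ.axis then -1 else 0

/-- The slot `s` holds the sticker `q`, for the given distances `α` and `β`. -/
def Holds {h : ℕ} (α β : ℕ) (q : Sticker) (s : S h) : Prop :=
  s.1.1.1 = α * coeff .xp q.1 + β * coeff .xp q.2.1 + h * coeff .xp q.2.2 ∧
  s.1.2.1.1 = α * coeff .yp q.1 + β * coeff .yp q.2.1 + h * coeff .yp q.2.2 ∧
  s.1.2.2.1 = α * coeff .zp q.1 + β * coeff .zp q.2.1 + h * coeff .zp q.2.2 ∧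
  s.2 = q.2.2

/-- The map `γ` on stickers describes the permutation `g` of slots. -/
def Describes {h : ℕ} (α β : ℕ) (γ : Sticker → Sticker) (g : Equiv.Perm (S h)) : Prop :=
  ∀ q s, Proper q → Holds α β q s → Proper (γ q) ∧ Holds α β (γ q) (g s)

theorem coeff_cases (δ d : Dir) :
    (d = δ ∧ d.axis = δ.axis ∧ coeff δ d = 1) ∨ (d ≠ δ ∧ d.axis = δ.axis ∧ coeff δ d = -1) ∨
      (d ≠ δ ∧ d.axis ≠ δ.axis ∧ coeff δ d = 0) := by
  revert δ d; decide

theorem coord_eq_iff {α β h k : ℕ} (hα : 0 < α) (hβ : 0 < β) (hh : 0 < h) (hk : 0 < k)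
    {q : Sticker} (hq : Proper q) (δ : Dir) :
    (α * coeff δ q.1 + β * coeff δ q.2.1 + h * coeff δ q.2.2 = k) ↔
      (q.1 = δ ∧ k = α) ∨ (q.2.1 = δ ∧ k = β) ∨ (q.2.2 = δ ∧ k = h) := by
  obtain ⟨h₁, h₂, h₃⟩ := hq
  rcases coeff_cases δ q.1 with ⟨a₁, a₂, a₃⟩ | ⟨a₁, a₂, a₃⟩ | ⟨a₁, a₂, a₃⟩ <;>
  rcases coeff_cases δ q.2.1 with ⟨b₁, b₂, b₃⟩ | ⟨b₁, b₂, b₃⟩ | ⟨b₁, b₂, b₃⟩ <;>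
  rcases coeff_cases δ q.2.2 with ⟨c₁, c₂, c₃⟩ | ⟨c₁, c₂, c₃⟩ | ⟨c₁, c₂, c₃⟩ <;>
  first
  | exact absurd (a₂.trans b₂.symm) h₁
  | exact absurd (a₂.trans c₂.symm) h₂
  | exact absurd (b₂.trans c₂.symm) h₃
  | (rw [a₃, b₃, c₃]; simp only [a₁, b₁, c₁, true_and, false_and, or_false, false_or,
      iff_false]; omega)

theorem Proper.turn {q : Sticker} (hq : Proper q) (δ : Dir) : Proper (turn δ q) := by
  obtain ⟨a, b, c⟩ := q
  revert δ a b c; decide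

/-- Quarter turn of the slice at distance `k` in direction `δ`. -/
def step (α β h : ℕ) (δ : Dir) (k : ℕ) (q : Sticker) : Sticker :=
  if (q.1 = δ ∧ k = α) ∨ (q.2.1 = δ ∧ k = β) ∨ (q.2.2 = δ ∧ k = h) then turn δ q else q

theorem coeff_rotX (d : Dir) : coeff .xp (rotX d) = coeff .xp d ∧
    coeff .yp (rotX d) = coeff .zp d ∧ coeff .zp (rotX d) = -coeff .yp d := by
  cases d <;> decide

theorem coeff_rotY (d : Dir) : coeff .yp (rotY d) = coeff .yp d ∧
    coeff .zp (rotY d) = coeff .xp d ∧ coeff .xp (rotY d) = -coeff .zp d := by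
  cases d <;> decide

theorem coeff_rotZ (d : Dir) : coeff .zp (rotZ d) = coeff .zp d ∧
    coeff .xp (rotZ d) = coeff .yp d ∧ coeff .yp (rotZ d) = -coeff .xp d := by
  cases d <;> decide

theorem I.val_neg {h : ℕ} (i : I h) : (-i).1 = -i.1 := rfl

section Describes

variable {h α β : ℕ}

theorem slot_eq_iff (hα : 0 < α) (hβ : 0 < β) {q : Sticker} (hq : Proper q) {δ δ' : Dir}
    (hδ : ∀ d, coeff δ' d = -coeff δ d) {x : I h}
    (hx : x.1 = α * coeff δ q.1 + β * coeff δ q.2.1 + h * coeff δ q.2.2) (v : I h) :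
    x = v ↔ (q.1 = (if 0 < v.1 then δ else δ') ∧ v.1.natAbs = α) ∨
      (q.2.1 = (if 0 < v.1 then δ else δ') ∧ v.1.natAbs = β) ∨
      (q.2.2 = (if 0 < v.1 then δ else δ') ∧ v.1.natAbs = h) := by
  have hv := v.2.1
  have hv' := v.2.2
  have hh : 0 < h := by
    have := abs_pos.mpr hv
    omega
  have e : x = v ↔ x.1 = v.1 := Subtype.ext_iff
  rw [← coord_eq_iff hα hβ hh (by omega : 0 < v.1.natAbs) hq, e, hx]
  split_ifs with h₀
  · omega
  · simp only [hδ, mul_neg]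
    omega

theorem describes_X (hα : 0 < α) (hβ : 0 < β) (v : I h) :
    Describes α β (step α β h (if 0 < v.1 then .xp else .xn) v.1.natAbs) (X v) := by
  rintro q ⟨⟨x, y, z⟩, d⟩ hq ⟨h₁, h₂, h₃, h₄⟩
  have iff := slot_eq_iff hα hβ hq (δ' := .xn) (fun d => by cases d <;> rfl) h₁ v
  unfold step
  by_cases hx : x = v
  · rw [if_pos (iff.mp hx)]
    have e : turn (if 0 < v.1 then .xp else .xn) q =
        (rotX q.1, rotX q.2.1, rotX q.2.2) := by
      split_ifs <;> rfl
    refine ⟨hq.turn _, ?_⟩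
    have e' : X v ((x, y, z), d) = ((x, z, -y), rotX d) := if_pos hx
    simp only at h₁ h₂ h₃ h₄
    rw [e, e']
    simp only [Holds, I.val_neg, coeff_rotX, h₁, h₂, h₃, h₄, and_true, true_and]
    ring
  · rw [if_neg (fun h' => hx (iff.mpr h'))]
    have e' : X v ((x, y, z), d) = ((x, y, z), d) := if_neg hx
    rw [e']
    exact ⟨hq, h₁, h₂, h₃, h₄⟩

theorem describes_Y (hα : 0 < α) (hβ : 0 < β) (v : I h) :
    Describes α β (step α β h (if 0 < v.1 then .yp else .yn) v.1.natAbs) (Y v) := by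
  rintro q ⟨⟨x, y, z⟩, d⟩ hq ⟨h₁, h₂, h₃, h₄⟩
  have iff := slot_eq_iff hα hβ hq (δ' := .yn) (fun d => by cases d <;> rfl) h₂ v
  unfold step
  by_cases hx : y = v
  · rw [if_pos (iff.mp hx)]
    have e : turn (if 0 < v.1 then .yp else .yn) q =
        (rotY q.1, rotY q.2.1, rotY q.2.2) := by
      split_ifs <;> rfl
    refine ⟨hq.turn _, ?_⟩
    have e' : Y v ((x, y, z), d) = ((-z, y, x), rotY d) := if_pos hx
    simp only at h₁ h₂ h₃ h₄
    rw [e, e']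
    simp only [Holds, I.val_neg, coeff_rotY, h₁, h₂, h₃, h₄, and_true]
    ring
  · rw [if_neg (fun h' => hx (iff.mpr h'))]
    have e' : Y v ((x, y, z), d) = ((x, y, z), d) := if_neg hx
    rw [e']
    exact ⟨hq, h₁, h₂, h₃, h₄⟩

theorem describes_Z (hα : 0 < α) (hβ : 0 < β) (v : I h) :
    Describes α β (step α β h (if 0 < v.1 then .zp else .zn) v.1.natAbs) (Z v) := by
  rintro q ⟨⟨x, y, z⟩, d⟩ hq ⟨h₁, h₂, h₃, h₄⟩
  have iff := slot_eq_iff hα hβ hq (δ' := .zn) (fun d => by cases d <;> rfl) h₃ v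
  unfold step
  by_cases hx : z = v
  · rw [if_pos (iff.mp hx)]
    have e : turn (if 0 < v.1 then .zp else .zn) q =
        (rotZ q.1, rotZ q.2.1, rotZ q.2.2) := by
      split_ifs <;> rfl
    refine ⟨hq.turn _, ?_⟩
    have e' : Z v ((x, y, z), d) = ((y, -x, z), rotZ d) := if_pos hx
    simp only at h₁ h₂ h₃ h₄
    rw [e, e']
    simp only [Holds, I.val_neg, coeff_rotZ, h₁, h₂, h₃, h₄, and_true, true_and]
    ring
  · rw [if_neg (fun h' => hx (iff.mpr h'))]
    have e' : Z v ((x, y, z), d) = ((x, y, z), d) := if_neg hx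
    rw [e']
    exact ⟨hq, h₁, h₂, h₃, h₄⟩

theorem Describes.one : Describes α β id (1 : Equiv.Perm (S h)) := fun _ _ hq hs => ⟨hq, hs⟩

theorem Describes.mul {γ γ' : Sticker → Sticker} {g g' : Equiv.Perm (S h)}
    (H : Describes α β γ g) (H' : Describes α β γ' g') : Describes α β (γ ∘ γ') (g * g') :=
  fun q s hq hs => H _ _ (H' q s hq hs).1 (H' q s hq hs).2

theorem Describes.pow {γ : Sticker → Sticker} {g : Equiv.Perm (S h)}
    (H : Describes α β γ g) (n : ℕ) : Describes α β γ^[n] (g ^ n) := by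
  induction n with
  | zero => exact .one
  | succ n ih => rw [pow_succ, Function.iterate_succ]; exact ih.mul H

theorem Describes.congr {γ γ' : Sticker → Sticker} {g : Equiv.Perm (S h)}
    (H : Describes α β γ g) (e : ∀ q, Proper q → γ q = γ' q) : Describes α β γ' g :=
  fun q s hq hs => by rw [← e q hq]; exact H q s hq hs

theorem exists_holds (hα : 0 < α) (hα' : α ≤ h) (hβ : 0 < β) (hβ' : β ≤ h) (q : Sticker)
    (hq : Proper q) : ∃ s : S h, Holds α β q s := by
  have lt : ∀ d : Dir, d.axis < 3 := by decide
  have key : ∀ δ, α * coeff δ q.1 + β * coeff δ q.2.1 + h * coeff δ q.2.2 ≠ 0 ∧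
      |α * coeff δ q.1 + β * coeff δ q.2.1 + h * coeff δ q.2.2| ≤ (h : ℤ) := by
    intro δ
    obtain ⟨h₁, h₂, h₃⟩ := hq
    have := lt q.1
    have := lt q.2.1
    have := lt q.2.2
    have := lt δ
    rcases coeff_cases δ q.1 with ⟨-, a₁, a₂⟩ | ⟨-, a₁, a₂⟩ | ⟨-, a₁, a₂⟩ <;>
    rcases coeff_cases δ q.2.1 with ⟨-, b₁, b₂⟩ | ⟨-, b₁, b₂⟩ | ⟨-, b₁, b₂⟩ <;>
    rcases coeff_cases δ q.2.2 with ⟨-, c₁, c₂⟩ | ⟨-, c₁, c₂⟩ | ⟨-, c₁, c₂⟩ <;>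
    first
    | omega
    | (rw [a₂, b₂, c₂, abs_le]; omega)
  exact ⟨((⟨_, key .xp⟩, ⟨_, key .yp⟩, ⟨_, key .zp⟩), q.2.2),
    rfl, rfl, rfl, rfl⟩

theorem Holds.unique {q : Sticker} {s s' : S h} (H : Holds α β q s) (H' : Holds α β q s') :
    s = s' := by
  obtain ⟨h₁, h₂, h₃, h₄⟩ := H
  obtain ⟨h₁', h₂', h₃', h₄'⟩ := H'
  exact Prod.ext (Prod.ext (Subtype.ext (h₁.trans h₁'.symm)) (Prod.ext
    (Subtype.ext (h₂.trans h₂'.symm)) (Subtype.ext (h₃.trans h₃'.symm)))) (h₄.trans h₄'.symm)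

theorem Describes.inv (hα : 0 < α) (hα' : α ≤ h) (hβ : 0 < β) (hβ' : β ≤ h)
    {γ γ' : Sticker → Sticker} {g : Equiv.Perm (S h)} (H : Describes α β γ g)
    (e : ∀ q, Proper q → Proper (γ' q) ∧ γ (γ' q) = q) : Describes α β γ' g⁻¹ := by
  intro q s hq hs
  obtain ⟨hq', e'⟩ := e q hq
  obtain ⟨s', hs'⟩ := exists_holds hα hα' hβ hβ' (γ' q) hq'
  have h₁ := (H _ _ hq' hs').2
  rw [e'] at h₁
  rw [hs.unique h₁, show g⁻¹ (g s') = s' from Equiv.symm_apply_apply g s']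
  exact ⟨hq', hs'⟩

theorem Holds.isSurface {q : Sticker} (hq : Proper q) {s : S h} (H : Holds α β q s) :
    IsSurface s := by
  obtain ⟨⟨x, y, z⟩, d⟩ := s
  obtain ⟨a, b, c⟩ := q
  obtain ⟨h₁, h₂, h₃, rfl⟩ := H
  obtain ⟨_, h₅, h₆⟩ := hq
  cases d
  all_goals
    simp only [IsSurface]
    first
    | (rw [h₁]; cases a <;> first | exact absurd rfl h₅ | cases b <;> 
        first | exact absurd rfl h₆ | simp [coeff, Dir.axis])
    | (rw [h₂]; cases a <;> first | exact absurd rfl h₅ | cases b <;> 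
        first | exact absurd rfl h₆ | simp [coeff, Dir.axis])
    | (rw [h₃]; cases a <;> first | exact absurd rfl h₅ | cases b <;> 
        first | exact absurd rfl h₆ | simp [coeff, Dir.axis])

end Describes

/-- A slice turn: `num` quarter turns of the slice at distance `idx` in direction `dir`. -/
structure Move where
  dir : Dir
  idx : ℕ
  num : Fin 4

/-- The action of a slice turn on stickers. -/
def Move.act (α β h : ℕ) (M : Move) : Sticker → Sticker := (step α β h M.dir M.idx)^[M.num]

/-- Perform the moves of a list, starting with its head. -/
def run (α β h : ℕ) (L : List Move) (q : Sticker) : Sticker :=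
  L.foldl (fun r M => M.act α β h r) q

theorem run_nil (α β h : ℕ) (q : Sticker) : run α β h [] q = q := rfl

theorem run_cons (α β h : ℕ) (M : Move) (L : List Move) (q : Sticker) :
    run α β h (M :: L) q = run α β h L (M.act α β h q) := rfl

theorem run_append (α β h : ℕ) (L L' : List Move) (q : Sticker) :
    run α β h (L ++ L') q = run α β h L' (run α β h L q) := List.foldl_append

theorem exists_move {h : ℕ} {g : Equiv.Perm (S h)} (hg : IsSTM g) :
    ∃ M : Move, 0 < M.idx ∧ M.idx ≤ h ∧ M.num ≠ 0 ∧
      ∀ α β, 0 < α → 0 < β → Describes α β (M.act α β h) g := by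
  obtain ⟨v, e, he, hg⟩ := hg
  have hv := v.2.1
  have hv' := abs_le.mp v.2.2
  have he4 : e < 4 := by omega
  have he0 : (⟨e, he4⟩ : Fin 4) ≠ 0 := by simp only [ne_eq, Fin.ext_iff]; simp; omega
  rcases hg with rfl | rfl | rfl
  · exact ⟨⟨_, _, ⟨e, he4⟩⟩, by show 0 < v.1.natAbs; omega, by show v.1.natAbs ≤ h; omega, he0,
      fun α β hα hβ => (describes_X hα hβ v).pow e⟩
  · exact ⟨⟨_, _, ⟨e, he4⟩⟩, by show 0 < v.1.natAbs; omega, by show v.1.natAbs ≤ h; omega, he0,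
      fun α β hα hβ => (describes_Y hα hβ v).pow e⟩
  · exact ⟨⟨_, _, ⟨e, he4⟩⟩, by show 0 < v.1.natAbs; omega, by show v.1.natAbs ≤ h; omega, he0,
      fun α β hα hβ => (describes_Z hα hβ v).pow e⟩

theorem describes_run {h α β k : ℕ} (g : Fin k → Equiv.Perm (S h)) (M : Fin k → Move)
    (H : ∀ q, Describes α β ((M q).act α β h) (g q)) :
    Describes α β (run α β h (List.ofFn M)) (List.ofFn g).reverse.prod := by
  induction k with
  | zero => rw [List.ofFn_zero, List.ofFn_zero]; exact .one
  | succ k ih =>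
    rw [List.ofFn_succ, List.ofFn_succ, List.reverse_cons, List.prod_append, List.prod_singleton]
    exact (ih _ _ fun q => H q.succ).mul (H 0)

theorem Describes.list_prod_id {h α β : ℕ} {ι : Type*} (F : ι → Equiv.Perm (S h)) (J : List ι)
    (H : ∀ i ∈ J, Describes α β id (F i)) : Describes α β id (J.map F).prod := by
  induction J with
  | nil => exact .one
  | cons i J ih =>
    rw [List.map_cons, List.prod_cons]
    exact (H i (by simp)).mul (ih fun k hk => H k (by simp [hk]))

theorem Describes.list_prod {h α β : ℕ} {ι : Type*} (F : ι → Equiv.Perm (S h)) {J : List ι}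
    (hJ : J.Nodup) {j : ι} (hj : j ∈ J) {γ : Sticker → Sticker} (Hj : Describes α β γ (F j))
    (H : ∀ i, i ≠ j → Describes α β id (F i)) : Describes α β γ (J.map F).prod := by
  induction J with
  | nil => simp at hj
  | cons i J ih =>
    rw [List.map_cons, List.prod_cons]
    obtain ⟨hi, hJ⟩ := List.nodup_cons.mp hJ
    by_cases e : i = j
    · subst e
      exact Hj.mul (.list_prod_id F J fun k hk => H k (by rintro rfl; exact hi hk))
    · exact (H i e).mul (ih hJ (by simpa [Ne.symm e] using hj))

theorem quarter_eq_self_iff (δ d : Dir) : quarter δ d = δ ↔ d = δ := by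
  revert δ d; decide

theorem step_iterate (α β h : ℕ) (δ : Dir) (k n : ℕ) (q : Sticker) :
    (step α β h δ k)^[n] q = if (q.1 = δ ∧ k = α) ∨ (q.2.1 = δ ∧ k = β) ∨ (q.2.2 = δ ∧ k = h)
      then (turn δ)^[n] q else q := by
  induction n generalizing q with
  | zero => simp
  | succ n ih =>
    rw [Function.iterate_succ_apply, ih, step]
    by_cases c : (q.1 = δ ∧ k = α) ∨ (q.2.1 = δ ∧ k = β) ∨ (q.2.2 = δ ∧ k = h)
    · simp only [if_pos c]
      simp only [turn, quarter_eq_self_iff, if_pos c]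
      rfl
    · simp only [if_neg c]

theorem Proper.step {q : Sticker} (hq : Proper q) (α β h : ℕ) (δ : Dir) (k : ℕ) :
    Proper (step α β h δ k q) := by
  unfold RC.step
  split_ifs
  exacts [hq.turn δ, hq]

theorem Proper.iterate {f : Sticker → Sticker} (hf : ∀ q, Proper q → Proper (f q)) (n : ℕ)
    {q : Sticker} (hq : Proper q) : Proper (f^[n] q) := by
  induction n with
  | zero => exact hq
  | succ n ih => rw [Function.iterate_succ_apply']; exact hf _ ih

theorem Proper.act {q : Sticker} (hq : Proper q) (α β h : ℕ) (M : Move) :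
    Proper (M.act α β h q) := Proper.iterate (fun _ hr => hr.step ..) _ hq

theorem Proper.run {q : Sticker} (hq : Proper q) (α β h : ℕ) (L : List Move) :
    Proper (run α β h L q) := by
  induction L generalizing q with
  | nil => exact hq
  | cons M L ih => exact ih (hq.act ..)

theorem Proper.turnA {q : Sticker} (hq : Proper q) (δ : Dir) : Proper (turnA δ q) := by
  unfold RC.turnA
  split_ifs
  exacts [hq.turn δ, hq]

theorem Proper.turnB {q : Sticker} (hq : Proper q) (δ : Dir) : Proper (turnB δ q) := by
  unfold RC.turnB
  split_ifs
  exacts [hq.turn δ, hq]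

theorem Proper.conjZ {q : Sticker} (hq : Proper q) (i : ℕ) : Proper (conjZ i q) :=
  .iterate (fun _ hr => hr.turnA _) _ ((Proper.iterate (fun _ hr => hr.turnA _) _ hq).turnB _)

theorem exists_run_eq (α β h : ℕ) (L : List Move) (p : Sticker) (hp : Proper p) :
    ∃ q, Proper q ∧ run α β h L q = p := by
  induction L generalizing p with
  | nil => exact ⟨p, hp, rfl⟩
  | cons M L ih =>
    obtain ⟨q, hq, e⟩ := ih p hp
    refine ⟨(step α β h M.dir M.idx)^[3 * M.num] q, .iterate (fun _ hr => hr.step ..) _ hq, ?_⟩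
    rw [run_cons, Move.act, ← Function.iterate_add_apply, step_iterate, ← turn_mod,
      show ((M.num : ℕ) + 3 * M.num) % 4 = 0 by omega]
    simpa using e

theorem Move.act_eq_self {α β h : ℕ} {M : Move} (h₁ : M.idx ≠ α) (h₂ : M.idx ≠ β)
    (h₃ : M.idx ≠ h) (q : Sticker) : M.act α β h q = q := by
  simp [Move.act, step_iterate, h₁, h₂, h₃]

theorem Move.act_eq_turnB {α β h : ℕ} {M : Move} (h₁ : M.idx ≠ α) (h₂ : M.idx = β)
    (h₃ : M.idx ≠ h) (q : Sticker) : M.act α β h q = (turnB M.dir)^[M.num] q := by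
  subst h₂
  have : step α M.idx h M.dir M.idx = turnB M.dir := by
    funext r
    simp only [step, turnB, h₁, h₃, and_true, and_false, or_false, false_or]
  rw [Move.act, this]

theorem Move.act_facing {α β h : ℕ} {M : Move} (h₁ : M.idx ≠ α) (h₂ : M.idx ≠ β)
    (q : Sticker) : (M.act α β h q).2.2 = q.2.2 := by
  refine Function.Iterate.rec (fun r : Sticker => r.2.2 = q.2.2) (a := q) rfl (fun r hr => ?_) _
  simp only [step, h₁, h₂, and_false, false_or]
  split_ifs with c
  · rw [← hr]
    show quarter M.dir r.2.2 = r.2.2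
    rw [c.1, quarter_eq_self_iff]
  · exact hr

theorem run_facing {α β h : ℕ} {L : List Move} (H : ∀ M ∈ L, M.idx ≠ α ∧ M.idx ≠ β)
    (q : Sticker) : (run α β h L q).2.2 = q.2.2 := by
  induction L generalizing q with
  | nil => rfl
  | cons M L ih =>
    rw [run_cons, ih fun M' hM' => H M' (by simp [hM'])]
    exact Move.act_facing (H M (by simp)).1 (H M (by simp)).2 q

theorem run_filter {α β h : ℕ} {p : Move → Bool} {L : List Move}
    (H : ∀ M ∈ L, p M = false → M.idx ≠ α ∧ M.idx ≠ β ∧ M.idx ≠ h) (q : Sticker) :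
    run α β h L q = run α β h (L.filter p) q := by
  induction L generalizing q with
  | nil => rfl
  | cons M L ih =>
    have ih := fun q => ih (fun M' hM' => H M' (by simp [hM'])) q
    rw [run_cons, ih]
    cases c : p M
    · obtain ⟨h₁, h₂, h₃⟩ := H M (by simp) c
      rw [List.filter_cons_of_neg (by simp [c]), Move.act_eq_self h₁ h₂ h₃]
    · rw [List.filter_cons_of_pos c, run_cons]

theorem run_congr {α β α' β' h : ℕ} {L : List Move}
    (H : ∀ M ∈ L, (M.idx = α ↔ M.idx = α') ∧ (M.idx = β ↔ M.idx = β')) (q : Sticker) :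
    run α β h L q = run α' β' h L q := by
  induction L generalizing q with
  | nil => rfl
  | cons M L ih =>
    obtain ⟨h₁, h₂⟩ := H M (by simp)
    rw [run_cons, run_cons, ih fun M' hM' => H M' (by simp [hM'])]
    congr 1
    simp only [Move.act, step_iterate, h₁, h₂]

/-- The total number of quarter turns of the slice at distance `α` in each direction. -/
def exponents (α : ℕ) : List Move → Dir → ℕ
  | [], _ => 0
  | M :: L, δ => (if M.idx = α ∧ M.dir = δ then (M.num : ℕ) else 0) + exponents α L δ

theorem exponents_append (α : ℕ) (L L' : List Move) (δ : Dir) :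
    exponents α (L ++ L') δ = exponents α L δ + exponents α L' δ := by
  induction L with
  | nil => simp [exponents]
  | cons M L ih => simp only [List.cons_append, exponents, ih]; ring

theorem run_eq_turnsA {α β h : ℕ} {L : List Move}
    (H : ∀ M ∈ L, M.idx ≠ β ∧ M.idx ≠ h) (q : Sticker) :
    run α β h L q = turnsA (exponents α L) q := by
  induction L generalizing q with
  | nil => rfl
  | cons M L ih =>
    obtain ⟨h₁, h₂⟩ := H M (by simp)
    have e : M.act α β h q =
        turnsA (fun δ => if M.idx = α ∧ M.dir = δ then (M.num : ℕ) else 0) q := by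
      rw [Move.act, step_iterate, turnsA]
      simp only [h₁, h₂, and_false, or_false]
      by_cases c : M.idx = α ∧ M.dir = q.1
      · rw [if_pos c, if_pos ⟨c.2.symm, c.1⟩, c.2]
      · rw [if_neg c, if_neg fun c' => c ⟨c'.2, c'.1.symm⟩]; rfl
    rw [run_cons, ih fun M' hM' => H M' (by simp [hM']), e, turnsA_add]
    exact turnsA_congr _ (by simp only [exponents, add_comm]; rfl)

/-- The bit of `w` for the slice at distance `α`; it is zero if there is no such bit. -/
def bitAt {m : ℕ} (w : Fin m → Bool) (α : ℕ) : Fin 2 :=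
  if ∃ j : Fin m, (j : ℕ) + 1 = α ∧ w j = true then 1 else 0

theorem bitAt_succ {m : ℕ} (w : Fin m → Bool) (j : Fin m) :
    bitAt w (j + 1) = if w j = true then 1 else 0 := by
  unfold bitAt
  congr 1
  rw [eq_iff_iff]
  refine ⟨?_, fun h => ⟨j, rfl, h⟩⟩
  rintro ⟨k, hk, h⟩
  obtain rfl : k = j := Fin.ext (by omega)
  exact h

theorem bitAt_of_lt {m : ℕ} (w : Fin m → Bool) {α : ℕ} (h : m < α) : bitAt w α = 0 := by
  refine if_neg ?_
  rintro ⟨j, hj, -⟩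
  have := j.2
  omega

section Scramble

variable {n m α β : ℕ}

theorem describes_X_colIdx (hα : 0 < α) (hβ : m < β) (hn : 0 < n) (j : Fin m) :
    Describes α β (if (j : ℕ) + 1 = α then turnA .xp else id) (X (colIdx (n := n) j)) := by
  have hj := j.2
  refine (describes_X hα (by omega) _).congr fun q _ => ?_
  have h₀ : (colIdx (n := n) j).1 = (j : ℕ) + 1 := rfl
  have h₁ : (colIdx (n := n) j).1.natAbs = j + 1 := by omega
  rw [if_pos (by omega), h₁]
  have h₂ : (j : ℕ) + 1 ≠ β := by omega
  have h₃ : (j : ℕ) + 1 ≠ hC n m := by unfold hC; omega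
  simp only [step, h₂, h₃, and_false, or_false]
  split_ifs with c₁ c₂ <;> simp_all [turnA]

theorem describes_Z_zIdx (hα : 0 < α) (hα' : α ≤ m ∨ m + n < α) (hβ : 0 < β) (i : Fin n) :
    Describes α β (if β = m + i + 1 then turnB .zp else id) (Z (zIdx (m := m) i)) := by
  have hi := i.2
  refine (describes_Z hα hβ _).congr fun q _ => ?_
  have h₀ : (zIdx (m := m) i).1 = (m : ℤ) + (i : ℕ) + 1 := rfl
  have h₁ : (zIdx (m := m) i).1.natAbs = m + i + 1 := by omega
  rw [if_pos (by omega), h₁]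
  have h₂ : m + (i : ℕ) + 1 ≠ α := by omega
  have h₃ : m + (i : ℕ) + 1 ≠ hC n m := by unfold hC; omega
  simp only [step, h₂, h₃, and_false, or_false, false_or, eq_comm (a := β)]
  split_ifs with c₁ c₂ <;> simp_all [turnB]

theorem describes_a (hα : 0 < α) (hβ : m < β) (l : Fin n → Fin m → Bool) (i : Fin n) :
    Describes α β (turnA .xp)^[bitAt (l i) α] (a l i) := by
  have hn : 0 < n := i.pos
  by_cases c : ∃ j : Fin m, (j : ℕ) + 1 = α
  · obtain ⟨j, rfl⟩ := c
    refine Describes.list_prod _ (List.nodup_finRange m) (List.mem_finRange j) ?_ fun k hk => ?_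
    · have := (describes_X_colIdx hα hβ hn j).pow (bitAt (l i) (j + 1))
      rw [if_pos rfl] at this
      convert this using 2
      rw [bitAt_succ]
      split_ifs <;> rfl
    · have := (describes_X_colIdx hα hβ hn k).pow (if l i k then 1 else 0)
      rwa [if_neg fun e => hk (Fin.ext (by omega)), Function.iterate_id] at this
  · have e : bitAt (l i) α = 0 := if_neg fun ⟨j, hj, _⟩ => c ⟨j, hj⟩
    rw [e]
    refine Describes.list_prod_id _ _ fun k _ => ?_
    have := (describes_X_colIdx hα hβ hn k).pow (if l i k then 1 else 0)
    rwa [if_neg fun e => c ⟨k, e⟩, Function.iterate_id] at this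

theorem turnA_iterate_inverse (δ : Dir) (k : ℕ) (q : Sticker) :
    (turnA δ)^[k] ((turnA δ)^[3 * k] q) = q := by
  rw [← Function.iterate_add_apply, turnA_iterate, ← turn_mod,
    show (k + 3 * k) % 4 = 0 by omega]
  simp

theorem describes_b (hα : 0 < α) (hα' : α ≤ m ∨ m + n < α) (hαh : α ≤ hC n m)
    (hβ : m < β) (hβh : β ≤ hC n m) (l : Fin n → Fin m → Bool) (i : Fin n) :
    Describes α β (if β = m + i + 1 then conjZ (bitAt (l i) α) else id) (b l i) := by
  have ha := describes_a hα hβ l i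
  have hinv := ha.inv (γ' := (turnA .xp)^[3 * (bitAt (l i) α : ℕ)]) hα hαh (by omega) hβh
    fun q hq => ⟨.iterate (fun _ hr => hr.turnA _) _ hq, turnA_iterate_inverse _ _ q⟩
  refine ((hinv.mul (describes_Z_zIdx hα hα' (by omega) i)).mul ha).congr fun q _ => ?_
  split_ifs
  · rfl
  · show (turnA .xp)^[3 * (bitAt (l i) α : ℕ)] ((turnA .xp)^[(bitAt (l i) α : ℕ)] q) = q
    rw [← Function.iterate_add_apply, add_comm, Function.iterate_add_apply,
      turnA_iterate_inverse]

theorem describes_t (hn : 0 < n) (hα : 0 < α) (hα' : α ≤ m ∨ m + n < α) (hαh : α ≤ hC n m)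
    (l : Fin n → Fin m → Bool) (i : Fin n) :
    Describes α (m + i + 1)
      (fun q => (turnA .xp)^[bitAt (l ⟨0, hn⟩) α] (conjZ (bitAt (l i) α) q)) (t hn l) := by
  have hi := i.2
  have hβ : m + (i : ℕ) + 1 ≤ hC n m := by unfold hC; omega
  refine (describes_a hα (by omega) l _).mul
    (Describes.list_prod _ (List.nodup_finRange n) (List.mem_finRange i) ?_ fun k hk => ?_)
  · simpa using describes_b hα hα' hαh (by omega) hβ l i
  · have := describes_b hα hα' hαh (by omega) hβ l k
    rwa [if_neg fun e => hk (Fin.ext (by omega))] at this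

theorem describes_t_of_lt (hn : 0 < n) (hα : 0 < α) (hα' : α ≤ m ∨ m + n < α)
    (hαh : α ≤ hC n m) (hβ : m + n < β) (hβh : β ≤ hC n m) (l : Fin n → Fin m → Bool) :
    Describes α β (turnA .xp)^[bitAt (l ⟨0, hn⟩) α] (t hn l) := by
  refine (describes_a hα (by omega) l _).mul (Describes.list_prod_id _ _ fun k _ => ?_)
  have := describes_b hα hα' hαh (by omega) hβh l k
  have hk := k.2
  rwa [if_neg (by omega)] at this

theorem facing_eq {g : Equiv.Perm (S (hC n m))} {φ : Dir → Dir}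
    (hφ : ∀ p : S (hC n m), IsSurface p → (g⁻¹ p).2 = φ p.2)
    (hα : 0 < α) (hα' : α ≤ hC n m) (hβ : 0 < β) (hβ' : β ≤ hC n m)
    {γ : Sticker → Sticker} (H : Describes α β γ g) (q : Sticker) (hq : Proper q) :
    q.2.2 = φ (γ q).2.2 := by
  obtain ⟨s, hs⟩ := exists_holds hα hα' hβ hβ' q hq
  obtain ⟨h₁, h₂⟩ := H q s hq hs
  have h₃ := hφ _ (h₂.isSurface h₁)
  rw [show g⁻¹ (g s) = s from Equiv.symm_apply_apply g s, hs.2.2.2, h₂.2.2.2] at h₃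
  exact h₃

end Scramble

theorem exists_filter_eq {ι : Type*} (A B : ι → Bool) {M : ι} (L : List ι)
    (hd : ∀ x ∈ L, B x = true → A x = false) (hB : L.filter B = [M]) :
    ∃ N ≤ (L.filter A).length,
      L.filter (fun x => A x || B x) = (L.filter A).take N ++ M :: (L.filter A).drop N := by
  induction L with
  | nil => simp at hB
  | cons x L ih =>
    have hd' : ∀ x ∈ L, B x = true → A x = false := fun y hy => hd y (by simp [hy])
    cases hx : B x with
    | true =>
      have hA := hd x (by simp) hx
      rw [List.filter_cons_of_pos hx, List.cons.injEq] at hB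
      obtain ⟨rfl, hB⟩ := hB
      refine ⟨0, by simp, ?_⟩
      rw [List.filter_cons_of_pos (by simp [hx]), List.filter_cons_of_neg (by simp [hA])]
      simp only [List.take_zero, List.nil_append, List.drop_zero, List.cons.injEq, true_and]
      rw [List.filter_eq_nil_iff] at hB
      exact List.filter_congr fun y hy => by simp [hB y hy]
    | false =>
      rw [List.filter_cons_of_neg (by simp [hx])] at hB
      obtain ⟨N, hN, e⟩ := ih hd' hB
      cases hA : A x with
      | true =>
        refine ⟨N + 1, ?_, ?_⟩
        · rw [List.filter_cons_of_pos hA]; simpa using hN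
        · rw [List.filter_cons_of_pos (by simp [hA]), List.filter_cons_of_pos hA, e]; rfl
      | false =>
        refine ⟨N, ?_, ?_⟩
        · rw [List.filter_cons_of_neg (by simp [hA])]; exact hN
        · rw [List.filter_cons_of_neg (by simp [hA, hx]), List.filter_cons_of_neg (by simp [hA]), e]

theorem exists_filter_eq_pair {ι : Type*} (A B : ι → Bool) {M M' : ι} (L : List ι)
    (hd : ∀ x ∈ L, B x = true → A x = false) (hB : L.filter B = [M, M']) :
    ∃ N N', N' + N ≤ (L.filter A).length ∧
      L.filter (fun x => A x || B x) = (L.filter A).take N ++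
        M :: (((L.filter A).drop N).take N' ++ M' :: (L.filter A).drop (N + N')) := by
  induction L with
  | nil => simp at hB
  | cons x L ih =>
    have hd' : ∀ x ∈ L, B x = true → A x = false := fun y hy => hd y (by simp [hy])
    cases hx : B x with
    | true =>
      have hA := hd x (by simp) hx
      rw [List.filter_cons_of_pos hx, List.cons.injEq] at hB
      obtain ⟨rfl, hB⟩ := hB
      obtain ⟨N, hN, e⟩ := exists_filter_eq A B L hd' hB
      refine ⟨0, N, ?_, ?_⟩
      · rw [List.filter_cons_of_neg (by simp [hA])]; exact hN
      · rw [List.filter_cons_of_pos (by simp [hx]), List.filter_cons_of_neg (by simp [hA]), e]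
        simp
    | false =>
      rw [List.filter_cons_of_neg (by simp [hx])] at hB
      obtain ⟨N, N', hN, e⟩ := ih hd' hB
      cases hA : A x with
      | true =>
        refine ⟨N + 1, N', ?_, ?_⟩
        · rw [List.filter_cons_of_pos hA, List.length_cons]; omega
        · rw [List.filter_cons_of_pos (by simp [hA]), List.filter_cons_of_pos hA, e,
            show N + 1 + N' = N + N' + 1 by omega]
          rfl
      | false =>
        refine ⟨N, N', ?_, ?_⟩
        · rw [List.filter_cons_of_neg (by simp [hA])]; exact hN
        · rw [List.filter_cons_of_neg (by simp [hA, hx]), List.filter_cons_of_neg (by simp [hA]), e]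

theorem run_eq_self {α β h : ℕ} {L : List Move}
    (H : ∀ M ∈ L, M.idx ≠ α ∧ M.idx ≠ β ∧ M.idx ≠ h) (q : Sticker) : run α β h L q = q := by
  rw [run_filter (p := fun _ => false) fun M hM _ => H M hM, List.filter_false, run_nil]

/-- The moves of `K`, with `e` quarter turns of the slice `β` in direction `δ` inserted after the
first `N` of them, undo the action of `X^x (X^y)⁻¹ Z X^y` on the facing directions. -/
def Crossing (α h : ℕ) (K : List Move) (N : ℕ) (δ : Dir) (e : Fin 4) (x y : Fin 2) : Prop :=
  ∀ q, Proper q → (run α 0 h (K.drop N) ((turnB δ)^[e]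
    (run α 0 h (K.take N) ((turnA .xp)^[x] (conjZ y q))))).2.2 = q.2.2

theorem turnB_zp_surjective {p : Sticker} (hp : Proper p) :
    ∃ q, Proper q ∧ turnB .zp q = p ∧ (q.2.2 = p.2.2 ∨ q.2.2 = rotZi p.2.2) := by
  have key : ∀ a b c, turnB .zp ((turnB .zp)^[3] (a, b, c)) = (a, b, c) ∧
      (((turnB .zp)^[3] (a, b, c)).2.2 = c ∨ ((turnB .zp)^[3] (a, b, c)).2.2 = rotZi c) := by
    decide
  exact ⟨(turnB .zp)^[3] p, .iterate (fun _ hr => hr.turnB _) _ hp, key p.1 p.2.1 p.2.2⟩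

section Crossing

variable {α h N N' : ℕ} {K : List Move} {δ δ' : Dir} {e : Fin 4} {x y y' : Fin 2}

theorem Crossing.eq_inverse (hK : ∀ M ∈ K, M.idx ≠ 0) (he : e ≠ 0)
    (H : Crossing 0 h K N δ e 0 0) : (δ = .zp ∨ δ = .zn) ∧ e = 3 := by
  refine turnB_eq_inverse δ e he fun p hp => ?_
  obtain ⟨q₁, hq₁, rfl⟩ := exists_run_eq 0 0 h (K.take N) p hp
  obtain ⟨q, hq, rfl, h'⟩ := turnB_zp_surjective hq₁
  rw [run_facing (L := K.take N) fun M hM =>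
    ⟨hK M (List.mem_of_mem_take hM), hK M (List.mem_of_mem_take hM)⟩]
  have := H q hq
  rw [run_facing fun M hM => ⟨hK M (List.mem_of_mem_drop hM), hK M (List.mem_of_mem_drop hM)⟩]
    at this
  rw [← this] at h'
  exact h'

theorem run_eq_turnC (h : ℕ) {Q : List Move} (hQ : ∀ M ∈ Q, M.idx ≠ 0) (hl : Q.length ≤ 1) :
    ∃ (ε : Dir) (e : Fin 4), ∀ α, (∀ M ∈ Q, M.idx ≠ α) →
      ∀ q, run α 0 h Q q = (turnC ε)^[e] q := by
  match Q, hl with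
  | [], _ => exact ⟨.xp, 0, fun _ _ _ => rfl⟩
  | [M], _ =>
    have h₀ := hQ M (by simp)
    by_cases c : M.idx = h
    · refine ⟨M.dir, M.num, fun α hα q => ?_⟩
      have hα := hα M (by simp)
      have : step α 0 h M.dir M.idx = turnC M.dir := by
        funext r
        rw [c] at hα h₀
        simp only [step, turnC, c, hα, h₀, and_true, and_false, false_or]
      rw [run_cons, run_nil, Move.act, this]
    · exact ⟨.xp, 0, fun α hα q => run_eq_self (by simpa using ⟨by simpa using hα, h₀, c⟩) q⟩

theorem Crossing.bit_eq (hK : ∀ M ∈ K, M.idx ≠ 0) (hN : N ≤ N') (hN' : N' ≤ N + 1)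
    (hδ : δ = .zp ∨ δ = .zn) (hδ' : δ' = .zp ∨ δ' = .zn)
    (H : Crossing 0 h K N δ 3 0 0) (H' : Crossing 0 h K N' δ' 3 0 0)
    (hα : ∀ M ∈ (K.take N').drop N, M.idx ≠ α)
    (G : Crossing α h K N δ 3 x y) (G' : Crossing α h K N' δ' 3 x y') : y = y' := by
  have hQ : ∀ M ∈ (K.take N').drop N, M.idx ≠ 0 := fun M hM =>
    hK M (List.mem_of_mem_take (List.mem_of_mem_drop hM))
  obtain ⟨ε, e, he⟩ := run_eq_turnC h hQ (by simp; omega)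
  have h₁ : K.take N' = K.take N ++ (K.take N').drop N := by
    conv_lhs => rw [← List.take_append_drop N (K.take N'), List.take_take, min_eq_left hN]
  have h₂ : K.drop N = (K.take N').drop N ++ K.drop N' := by
    conv_lhs => rw [← List.take_append_drop N' K]
    rw [List.drop_append, List.length_take]
    rcases le_total N' K.length with c | c
    · rw [min_eq_left c, Nat.sub_eq_zero_of_le hN, List.drop_zero]
    · rw [List.drop_eq_nil_of_le c, List.drop_nil]
  generalize (K.take N').drop N = Q at *
  unfold Crossing at H H' G G'
  simp only [h₁, h₂, run_append, he 0 hQ] at H H'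
  simp only [h₁, h₂, run_append, he α hα] at G G'
  have comm := turnC_commutes δ δ' hδ hδ' ε e fun p hp => by
    obtain ⟨q₁, hq₁, rfl⟩ := exists_run_eq 0 0 h (K.take N) p hp
    obtain ⟨q, hq, rfl, -⟩ := turnB_zp_surjective hq₁
    have e₁ := H q hq
    have e₂ := H' q hq
    have hd : ∀ M ∈ K.drop N', M.idx ≠ 0 ∧ M.idx ≠ 0 := fun M hM =>
      ⟨hK M (List.mem_of_mem_drop hM), hK M (List.mem_of_mem_drop hM)⟩
    rw [← he 0 hQ, ← run_append, run_facing] at e₁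
    · rw [run_facing hd] at e₂
      exact e₁.trans e₂.symm
    · intro M hM
      rcases List.mem_append.mp hM with hM | hM
      exacts [⟨hQ M hM, hQ M hM⟩, hd M hM]
  refine conjZ_bit y y' fun q r hq hr hqr => ?_
  rw [← G q hq, ← G' r hr, ← hqr]
  refine congrArg (fun p => (run α 0 h (K.drop N') p).2.2) (comm _ ?_).symm
  exact (Proper.iterate (fun _ hr => hr.turnA _) _ (hq.conjZ _)).run ..

theorem Crossing.eq_zp (hK : ∀ M ∈ K, M.idx ≠ 0) (hK' : ∀ M ∈ K, M.idx ≠ h)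
    (hδ : δ = .zp ∨ δ = .zn) (H : Crossing 0 h K N δ 3 0 0) : δ = .zp := by
  refine turnB_single δ hδ fun q hq => ?_
  have := H q hq
  rw [run_eq_self, run_eq_self] at this
  · exact this
  · exact fun M hM => ⟨hK M (List.mem_of_mem_take hM), hK M (List.mem_of_mem_take hM),
      hK' M (List.mem_of_mem_take hM)⟩
  · exact fun M hM => ⟨hK M (List.mem_of_mem_drop hM), hK M (List.mem_of_mem_drop hM),
      hK' M (List.mem_of_mem_drop hM)⟩

/-- The exponents of the first `N` moves of `K` preceded by `X^x`. -/
def partialExponents (α : ℕ) (K : List Move) (x : Fin 2) (N : ℕ) (δ : Dir) : ℕ :=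
  exponents α (K.take N) δ + if δ = .xp then (x : ℕ) else 0

theorem run_turnA {β : ℕ} (hK : ∀ M ∈ K, M.idx ≠ β ∧ M.idx ≠ h) (N : ℕ) (q : Sticker) :
    run α β h (K.take N) ((turnA .xp)^[x] q) = turnsA (partialExponents α K x N) q := by
  rw [run_eq_turnsA fun M hM => hK M (List.mem_of_mem_take hM), turnA_eq_turnsA, turnsA_add]
  rfl

theorem exponents_drop_take (α : ℕ) (K : List Move) (x : Fin 2) (N N' : ℕ) (δ : Dir) :
    exponents α ((K.drop N).take N') δ + partialExponents α K x N δ =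
      partialExponents α K x (N + N') δ := by
  unfold partialExponents
  rw [List.take_add, exponents_append]
  ring

theorem exponents_drop (hx : ∀ δ, partialExponents α K x K.length δ ≡ 0 [MOD 4]) (N : ℕ)
    (δ : Dir) : exponents α (K.drop N) δ ≡ 3 * partialExponents α K x N δ [MOD 4] := by
  have h₁ := hx δ
  have h₂ : partialExponents α K x K.length δ =
      partialExponents α K x N δ + exponents α (K.drop N) δ := by
    unfold partialExponents
    rw [List.take_length]
    conv_lhs => rw [← List.take_append_drop N K, exponents_append]
    ring
  rw [h₂] at h₁
  unfold Nat.ModEq at *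
  omega

theorem Crossing.partialExponents_eq (hK : ∀ M ∈ K, M.idx ≠ 0 ∧ M.idx ≠ h)
    (hx : ∀ δ, partialExponents α K x K.length δ ≡ 0 [MOD 4])
    (H : Crossing α h K N .zp 3 x y) :
    partialExponents α K x N .xp ≡ y [MOD 4] ∧ partialExponents α K x N .xn ≡ 0 [MOD 4] ∧
      partialExponents α K x N .yp ≡ 0 [MOD 4] ∧ partialExponents α K x N .yn ≡ 0 [MOD 4] := by
  refine exponents_eq (partialExponents α K x N) y fun q hq => ?_
  have := H q hq
  rw [show ((3 : Fin 4) : ℕ) = 3 from rfl, run_turnA hK,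
    run_eq_turnsA fun M hM => hK M (List.mem_of_mem_drop hM),
    turnsA_congr (r := fun δ => 3 * partialExponents α K x N δ) _ (exponents_drop hx N _)] at this
  exact this

/-- Two crossings of a row force its bit to agree with those of the rows crossing once at the
same times. -/
theorem bit_eq_of_two_crossings (hK : ∀ M ∈ K, M.idx ≠ 0 ∧ M.idx ≠ h)
    (hx : ∀ δ, partialExponents α K x K.length δ ≡ 0 [MOD 4]) (he : e = 1 ∨ e = 2)
    {i c₁ c₂ : Fin 2} (H₁ : Crossing α h K N .zp 3 x c₁) (H₂ : Crossing α h K (N + N') .zp 3 x c₂)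
    (H : ∀ q, Proper q → (run α 0 h (K.drop (N + N')) ((turnB .zp)^[3 - e]
      (run α 0 h ((K.drop N).take N') ((turnB .zp)^[e]
        (run α 0 h (K.take N) ((turnA .xp)^[x] (conjZ i q))))))).2.2 = q.2.2) : c₁ = i := by
  obtain ⟨a₁, a₂, a₃, a₄⟩ := H₁.partialExponents_eq hK hx
  obtain ⟨b₁, b₂, b₃, b₄⟩ := H₂.partialExponents_eq hK hx
  have mid (δ : Dir) {u v : ℕ} (hu : partialExponents α K x N δ ≡ u [MOD 4])
      (hv : partialExponents α K x (N + N') δ ≡ v [MOD 4]) :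
      exponents α ((K.drop N).take N') δ ≡ v + 3 * u [MOD 4] := by
    rw [← exponents_drop_take] at hv
    unfold Nat.ModEq at *
    omega
  have last := exponents_drop hx (N + N')
  refine (two_turns_eq e he c₁ c₂ i fun q hq hz => ?_).1
  have hz₁ : OffZ ((turnB .zp)^[e] ((turnA .xp)^[c₁] (conjZ i q))) := by
    rw [turnA_eq_turnsA]
    exact ((hz.conjZ _).turnsA _).turnB_iterate _
  have hz₂ : OffZ ((turnB .zp)^[3 - e] ((turnA .xp)^[c₂ + 3 * c₁]
      ((turnB .zp)^[e] ((turnA .xp)^[c₁] (conjZ i q))))) := by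
    rw [turnA_eq_turnsA _ (c₂ + 3 * c₁)]
    exact (hz₁.turnsA _).turnB_iterate _
  have := H q hq
  rwa [run_turnA hK, turnsA_eq_turnA a₁ a₂ a₃ a₄ (hz.conjZ _),
    run_eq_turnsA fun M hM => hK M (List.mem_of_mem_drop (List.mem_of_mem_take hM)),
    turnsA_eq_turnA (n := c₂ + 3 * c₁) (mid _ a₁ b₁) (mid _ a₂ b₂) (mid _ a₃ b₃)
      (mid _ a₄ b₄) hz₁,
    run_eq_turnsA fun M hM => hK M (List.mem_of_mem_drop hM),
    turnsA_eq_turnA (n := 3 * c₂) ((last _).trans (b₁.mul_left 3)) ((last _).trans (b₂.mul_left 3))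
      ((last _).trans (b₃.mul_left 3)) ((last _).trans (b₄.mul_left 3)) hz₂] at this

end Crossing

section Solution

variable {n m : ℕ}

/-- A list of moves which acts on the stickers of the scrambled cube like a solution, together
with the distance `u` of a slice that it does not move. -/
structure Solution (l : Fin n → Fin m → Bool) (x : ℕ → Fin 2) (L : List Move) (u : ℕ) : Prop where
  idx_pos : ∀ M ∈ L, 0 < M.idx
  num_ne : ∀ M ∈ L, M.num ≠ 0
  lt_free : m + n < u
  idx_ne : ∀ M ∈ L, M.idx ≠ u
  bit_zero : x u = 0
  facing_row : ∀ α, 0 < α → (α ≤ m ∨ α = u) → ∀ (i : Fin n) q, Proper q →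
    (run α (m + i + 1) (hC n m) L ((turnA .xp)^[x α] (conjZ (bitAt (l i) α) q))).2.2 = q.2.2
  facing_free : ∀ α, 0 < α → α ≤ m → ∀ q, Proper q →
    (run α u (hC n m) L ((turnA .xp)^[x α] q)).2.2 = q.2.2

theorem exists_solution (hn : 0 < n) (l : Fin n → Fin m → Bool) {k : ℕ} (hk : k ≤ 2 * n - 1)
    (g : Fin k → Equiv.Perm (S (hC n m))) (hSTM : ∀ q, IsSTM (g q))
    (hmono : ∀ d : Dir, ∃ d₀ : Dir, ∀ p : S (hC n m), IsSurface p → p.2 = d →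
      (((List.ofFn g).reverse.prod * t hn l)⁻¹ p).2 = d₀) :
    ∃ L u, L.length = k ∧ Solution l (bitAt (l ⟨0, hn⟩)) L u := by
  choose M hpos hle hnum hM using fun q => exists_move (hSTM q)
  choose φ hφ using hmono
  obtain ⟨u, hu, hu'⟩ : ∃ u ∈ Finset.Icc (m + n + 1) (m + 3 * n),
      u ∉ Finset.univ.image fun q => (M q).idx := by
    apply Finset.exists_mem_notMem_of_card_lt_card
    have := Finset.card_image_le (s := Finset.univ) (f := fun q => (M q).idx)
    rw [Finset.card_univ, Fintype.card_fin] at this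
    rw [Nat.card_Icc]
    omega
  rw [Finset.mem_Icc] at hu
  have hne : ∀ q, (M q).idx ≠ u := fun q h => hu' (Finset.mem_image.mpr ⟨q, Finset.mem_univ _, h⟩)
  have hne' : ∀ N ∈ List.ofFn M, N.idx ≠ u := by simpa [List.mem_ofFn] using hne
  have hrun (α β : ℕ) (hα : 0 < α) (hβ : 0 < β) :=
    describes_run g M fun q => hM q α β hα hβ
  have hh : hC n m = m + 3 * n := rfl
  have facing (α β : ℕ) (hα : 0 < α) (hα' : α ≤ hC n m) (hβ : 0 < β) (hβ' : β ≤ hC n m) {γ}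
      (H : Describes α β γ (t hn l)) (q : Sticker) (hq : Proper q) :
      q.2.2 = φ (run α β (hC n m) (List.ofFn M) (γ q)).2.2 :=
    facing_eq (fun p hp => hφ _ p hp rfl) hα hα' hβ hβ' ((hrun α β hα hβ).mul H) q hq
  have hφid : ∀ d, φ d = d := by
    have key : ∀ d : Dir, ∃ a b, Proper (a, b, d) := by
      intro d
      cases d
      exacts [⟨.yp, .zp, by decide⟩, ⟨.yp, .zp, by decide⟩, ⟨.xp, .zp, by decide⟩,
        ⟨.xp, .zp, by decide⟩, ⟨.xp, .yp, by decide⟩, ⟨.xp, .yp, by decide⟩]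
    intro d
    obtain ⟨a, b, hq⟩ := key d
    have := facing u u (by omega) (by omega) (by omega) (by omega) (describes_t_of_lt hn
      (by omega) (by omega) (by omega) (by omega) (by omega) l) _ hq
    rw [run_facing fun N hN => ⟨hne' N hN, hne' N hN⟩, bitAt_of_lt _ (by omega)] at this
    exact this.symm
  simp only [hφid] at facing
  refine ⟨List.ofFn M, u, List.length_ofFn, ?_, ?_, by omega, hne', bitAt_of_lt _ (by omega), ?_, ?_⟩
  · simpa [List.mem_ofFn] using hpos
  · simpa [List.mem_ofFn] using hnum
  · intro α hα hα' i q hq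
    have hi := i.2
    exact (facing _ _ hα (by omega) (by omega) (by omega)
      (describes_t hn hα (by omega) (by omega) l i) q hq).symm
  · intro α hα hα' q hq
    exact (facing _ _ hα (by omega) (by omega) (by omega)
      (describes_t_of_lt hn hα (by omega) (by omega) (by omega) (by omega) l) q hq).symm

/-- The moves of slices which are not one of the rows `m + 1, …, m + n`. -/
def offRow (n m : ℕ) (M : Move) : Bool := decide (M.idx ≤ m ∨ m + n < M.idx)

/-- The moves of the row `i`. -/
def inRow (i : Fin n) (m : ℕ) (M : Move) : Bool := decide (M.idx = m + i + 1)

theorem inRow_offRow {i : Fin n} {M : Move} (h : inRow i m M = true) : offRow n m M = false := by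
  have := i.2
  simp only [inRow, offRow, decide_eq_true_eq, decide_eq_false_iff_not] at *
  omega

theorem sum_length_filter_inRow (L : List Move) :
    ∑ i : Fin n, (L.filter (inRow i m)).length + (L.filter (offRow n m)).length = L.length := by
  induction L with
  | nil => simp
  | cons M L ih =>
    have e (p : Move → Bool) : ((M :: L).filter p).length =
        (if p M = true then 1 else 0) + (L.filter p).length := by
      rw [List.filter_cons]
      split_ifs <;> simp [add_comm]
    simp only [e, Finset.sum_add_distrib, List.length_cons]
    have : ∑ i : Fin n, (if inRow i m M = true then 1 else 0) +
        (if offRow n m M = true then 1 else 0) = 1 := by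
      by_cases c : M.idx ≤ m ∨ m + n < M.idx
      · rw [if_pos (by simpa [offRow] using c), Finset.sum_eq_zero]
        intro i _
        have := i.2
        rw [if_neg]
        simp only [inRow, decide_eq_true_eq]
        omega
      · rw [if_neg (by simpa [offRow] using c), Finset.sum_eq_single ⟨M.idx - m - 1, by omega⟩]
        · rw [if_pos]
          simp only [inRow, decide_eq_true_eq]
          omega
        · intro i _ hi
          rw [if_neg]
          simp only [inRow, decide_eq_true_eq]
          rintro h
          exact hi (Fin.ext (by simp; omega))
        · simp
    omega

/-- The row `i` is turned by three quarter turns in direction `δ`, after the first `N` moves of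
`K`, and this solves the stickers that it contains. -/
def Crosses (l : Fin n → Fin m → Bool) (x : ℕ → Fin 2) (K : List Move) (i : Fin n) (N : ℕ)
    (δ : Dir) : Prop :=
  (δ = .zp ∨ δ = .zn) ∧ Crossing 0 (hC n m) K N δ 3 0 0 ∧
    ∀ j : Fin m, Crossing (j + 1) (hC n m) K N δ 3 (x (j + 1)) (bitAt (l i) (j + 1))

variable {l : Fin n → Fin m → Bool} {x : ℕ → Fin 2} {L K : List Move} {u : ℕ}

theorem bitAt_inj {w w' : Fin m → Bool} {j : Fin m} (h : bitAt w (j + 1) = bitAt w' (j + 1)) :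
    w j = w' j := by
  rw [bitAt_succ, bitAt_succ] at h
  cases c : w j <;> cases c' : w' j <;> simp [c, c'] at h ⊢

theorem Crosses.eq_of_not_mem {i i' : Fin n} {N N' : ℕ} {δ δ' : Dir}
    (hK : ∀ M ∈ K, M.idx ≠ 0) (H : Crosses l x K i N δ) (H' : Crosses l x K i' N' δ')
    (hN : N ≤ N') (hN' : N' ≤ N + 1) {j : Fin m}
    (hj : ∀ M ∈ (K.take N').drop N, M.idx ≠ j + 1) : l i j = l i' j :=
  bitAt_inj (Crossing.bit_eq hK hN hN' H.1 H'.1 H.2.1 H'.2.1 hj (H.2.2 j) (H'.2.2 j))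

namespace Solution

theorem offRow_idx (H : Solution l x L u) (i : Fin n) {M : Move}
    (hM : M ∈ L.filter (offRow n m)) :
    M.idx ≠ m + i + 1 ∧ M.idx ≠ 0 ∧ M.idx ≠ u := by
  have h₁ := (List.mem_filter.mp hM).2
  have h₂ := H.idx_pos M (List.mem_filter.mp hM).1
  have h₃ := H.idx_ne M (List.mem_filter.mp hM).1
  have hi := i.2
  simp only [offRow, decide_eq_true_eq] at h₁
  omega

theorem run_filter_or (H : Solution l x L u) (i : Fin n) {α : ℕ} (hα : α ≤ m ∨ α = u)
    (q : Sticker) : run α (m + i + 1) (hC n m) L q =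
      run α (m + i + 1) (hC n m) (L.filter fun M => offRow n m M || inRow i m M) q := by
  refine run_filter (fun M hM h => ?_) q
  have hi := i.2
  have hu := H.lt_free
  simp only [offRow, inRow, Bool.or_eq_false_iff, decide_eq_false_iff_not] at h
  have hh : hC n m = m + 3 * n := rfl
  omega

theorem run_row {α : ℕ} (H : Solution l x L u) (i : Fin n) (hα : α ≤ m)
    {K : List Move} (hK : ∀ M ∈ K, M ∈ L.filter (offRow n m)) (q : Sticker) :
    run α (m + i + 1) (hC n m) K q = run α 0 (hC n m) K q :=
  run_congr (fun M hM => by have := H.offRow_idx i (hK M hM); omega) q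

theorem run_free (H : Solution l x L u) (i : Fin n)
    {K : List Move} (hK : ∀ M ∈ K, M ∈ L.filter (offRow n m)) (q : Sticker) :
    run u (m + i + 1) (hC n m) K q = run 0 0 (hC n m) K q :=
  run_congr (fun M hM => by have := H.offRow_idx i (hK M hM); omega) q

theorem inRow_act (H : Solution l x L u) {i : Fin n} {α : ℕ} (hα : α ≤ m ∨ α = u) {M : Move}
    (hM : M ∈ L.filter (inRow i m)) (q : Sticker) :
    M.act α (m + i + 1) (hC n m) q = (turnB M.dir)^[M.num] q := by
  have h := (List.mem_filter.mp hM).2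
  have hi := i.2
  have hu := H.lt_free
  simp only [inRow, decide_eq_true_eq] at h
  have hh : hC n m = m + 3 * n := rfl
  exact Move.act_eq_turnB (by omega) h (by omega) q

theorem filter_inRow_ne_nil (H : Solution l x L u) (i : Fin n) : L.filter (inRow i m) ≠ [] := by
  intro h
  rw [List.filter_eq_nil_iff] at h
  have := H.facing_row u (by have := H.lt_free; omega) (.inr rfl) i (.xp, .zp, .yp) (by decide)
  rw [run_facing fun M hM => ⟨H.idx_ne M hM, by simpa [inRow] using h M hM⟩, H.bit_zero,
    bitAt_of_lt _ (by have := H.lt_free; omega)] at this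
  revert this
  decide

theorem exists_crosses (H : Solution l x L u) (i : Fin n)
    (hi : (L.filter (inRow i m)).length = 1) :
    ∃ N δ, N ≤ (L.filter (offRow n m)).length ∧ Crosses l x (L.filter (offRow n m)) i N δ := by
  obtain ⟨M, hM⟩ := List.length_eq_one_iff.mp hi
  obtain ⟨N, hN, e⟩ := exists_filter_eq (offRow n m) (inRow i m) L (fun M _ => inRow_offRow) hM
  have hmem : M ∈ L.filter (inRow i m) := by simp [hM]
  have ht : ∀ M ∈ (L.filter (offRow n m)).take N, M ∈ L.filter (offRow n m) := fun _ =>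
    List.mem_of_mem_take
  have hd : ∀ M ∈ (L.filter (offRow n m)).drop N, M ∈ L.filter (offRow n m) := fun _ =>
    List.mem_of_mem_drop
  have free : Crossing 0 (hC n m) (L.filter (offRow n m)) N M.dir M.num 0 0 := fun q hq => by
    have := H.facing_row u (by have := H.lt_free; omega) (.inr rfl) i q hq
    rwa [H.run_filter_or i (.inr rfl), e, run_append, run_cons, H.inRow_act (.inr rfl) hmem,
      H.run_free i ht, H.run_free i hd, H.bit_zero,
      bitAt_of_lt _ (by have := H.lt_free; omega)] at this
  obtain ⟨hδ, h3⟩ := free.eq_inverse (fun M hM => (H.offRow_idx i hM).2.1)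
    (H.num_ne M (List.mem_filter.mp hmem).1)
  rw [h3] at free
  refine ⟨N, M.dir, hN, hδ, free, fun j q hq => ?_⟩
  have hj : (j : ℕ) + 1 ≤ m := j.2
  have := H.facing_row (j + 1) (by omega) (.inl hj) i q hq
  rwa [H.run_filter_or i (.inl hj), e, run_append, run_cons, H.inRow_act (.inl hj) hmem,
    H.run_row i hj ht, H.run_row i hj hd, h3] at this

theorem partialExponents_eq_zero (H : Solution l x L u) (hK : ∀ M ∈ L.filter (offRow n m), M.idx ≤ m)
    (hn : 0 < n) (j : Fin m) (δ : Dir) :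
    partialExponents (j + 1) (L.filter (offRow n m)) (x (j + 1)) (L.filter (offRow n m)).length δ
      ≡ 0 [MOD 4] := by
  have hj : (j : ℕ) + 1 ≤ m := j.2
  have hu := H.lt_free
  refine turnsA_eq_zero _ (fun q hq => ?_) δ
  have := H.facing_free (j + 1) (by omega) hj q hq
  have hh : hC n m = m + 3 * n := rfl
  rw [run_filter (p := offRow n m)] at this
  · rwa [← run_turnA (β := u) (h := hC n m), List.take_length]
    intro M hM
    have := hK M hM
    omega
  · intro M _ h
    simp only [offRow, decide_eq_false_iff_not] at h
    omega

theorem length_filter_inRow_ne_two (H : Solution l x L u)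
    (hK : ∀ M ∈ L.filter (offRow n m), M.idx ≤ m) (hl : Function.Injective l)
    (hcov : ∀ p ≤ (L.filter (offRow n m)).length, ∃ i δ,
      (L.filter (inRow i m)).length = 1 ∧ Crosses l x (L.filter (offRow n m)) i p δ)
    (i : Fin n) : (L.filter (inRow i m)).length ≠ 2 := by
  intro hi
  have hn : 0 < n := i.pos
  have hu := H.lt_free
  have hh : hC n m = m + 3 * n := rfl
  have hx := H.partialExponents_eq_zero hK hn
  have hK' : ∀ M ∈ L.filter (offRow n m), M.idx ≠ 0 ∧ M.idx ≠ hC n m := fun M hM => by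
    have h₁ := hK M hM
    have h₂ := (H.offRow_idx i hM).2.1
    omega
  obtain ⟨M, M', hM⟩ := List.length_eq_two.mp hi
  obtain ⟨N, N', hN, e⟩ :=
    exists_filter_eq_pair (offRow n m) (inRow i m) L (fun M _ => inRow_offRow) hM
  have hmem : M ∈ L.filter (inRow i m) := by simp [hM]
  have hmem' : M' ∈ L.filter (inRow i m) := by simp [hM]
  have ht : ∀ M ∈ (L.filter (offRow n m)).take N, M ∈ L.filter (offRow n m) := fun _ =>
    List.mem_of_mem_take
  have hd : ∀ M ∈ (L.filter (offRow n m)).drop (N + N'), M ∈ L.filter (offRow n m) := fun _ =>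
    List.mem_of_mem_drop
  have hc : ∀ M ∈ ((L.filter (offRow n m)).drop N).take N', M ∈ L.filter (offRow n m) :=
    fun _ h => List.mem_of_mem_drop (List.mem_of_mem_take h)
  have hself : ∀ {K : List Move}, (∀ M ∈ K, M ∈ L.filter (offRow n m)) → ∀ q,
      run u (m + i + 1) (hC n m) K q = q := fun h => run_eq_self fun M hM =>
    ⟨(H.offRow_idx i (h M hM)).2.2, (H.offRow_idx i (h M hM)).1, (hK' M (h M hM)).2⟩
  have h₀ := H.num_ne M (List.mem_filter.mp hmem).1
  have h₀' := H.num_ne M' (List.mem_filter.mp hmem').1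
  obtain ⟨hδ, hδ', hsum⟩ := turnB_pair M.dir M'.dir M.num M'.num h₀ h₀' fun q hq => by
    have := H.facing_row u (by omega) (.inr rfl) i q hq
    rwa [H.run_filter_or i (.inr rfl), e, run_append, run_cons, H.inRow_act (.inr rfl) hmem,
      run_append, run_cons, H.inRow_act (.inr rfl) hmem', hself ht, hself hc, hself hd,
      H.bit_zero, bitAt_of_lt _ (by omega)] at this
  have hnum : M.num = 1 ∨ M.num = 2 := by
    simp only [Fin.ext_iff, ne_eq] at h₀ h₀' ⊢
    simp at h₀ h₀' ⊢
    omega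
  obtain ⟨i₁, δ₁, hi₁, hδ₁, g₁, G₁⟩ := hcov N (by omega)
  obtain ⟨i₂, δ₂, -, hδ₂, g₂, G₂⟩ := hcov (N + N') (by omega)
  obtain rfl := g₁.eq_zp (fun M hM => (hK' M hM).1) (fun M hM => (hK' M hM).2) hδ₁
  obtain rfl := g₂.eq_zp (fun M hM => (hK' M hM).1) (fun M hM => (hK' M hM).2) hδ₂
  have : i₁ = i := hl (funext fun j => bitAt_inj ?_)
  · rw [this] at hi₁
    omega
  have hj : (j : ℕ) + 1 ≤ m := j.2
  refine bit_eq_of_two_crossings hK' (hx j) hnum (G₁ j) (G₂ j) fun q hq => ?_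
  have := H.facing_row (j + 1) (by omega) (.inl hj) i q hq
  rwa [H.run_filter_or i (.inl hj), e, run_append, run_cons, H.inRow_act (.inl hj) hmem,
    run_append, run_cons, H.inRow_act (.inl hj) hmem', H.run_row i hj ht, H.run_row i hj hc,
    H.run_row i hj hd, hδ, hδ', show (M'.num : ℕ) = 3 - M.num by omega] at this

end Solution

end Solution

theorem eq_one_or_eq_two {n κ : ℕ} (hn : 0 < n) (f N : Fin n → ℕ) (hf : ∀ i, f i ≠ 0)
    (hs : ∑ i, f i + κ ≤ 2 * n - 1) (hN : ∀ i, f i = 1 → N i ≤ κ)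
    (hinj : ∀ i i', f i = 1 → f i' = 1 → N i = N i' → i = i') :
    (∀ p ≤ κ, ∃ i, f i = 1 ∧ N i = p) ∧ ∀ i, f i = 1 ∨ f i = 2 := by
  set O := Finset.univ.filter fun i => f i = 1 with hO
  have hle (i : Fin n) : 2 ≤ f i + if f i = 1 then 1 else 0 := by
    have := hf i
    split_ifs <;> omega
  have hsum : ∑ i, (f i + if f i = 1 then 1 else 0) = ∑ i, f i + O.card := by
    rw [Finset.sum_add_distrib, Finset.card_filter]
  have htwo : ∑ _i : Fin n, 2 = 2 * n := by simp [mul_comm]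
  have hlow := Finset.sum_le_sum fun i (_ : i ∈ Finset.univ) => hle i
  have hinj' : Set.InjOn N O := fun i hi i' hi' h => hinj i i' (by simpa [hO] using hi)
    (by simpa [hO] using hi') h
  have himg : O.image N ⊆ Finset.range (κ + 1) := by
    intro p hp
    obtain ⟨i, hi, rfl⟩ := Finset.mem_image.mp hp
    have := hN i (by simpa [hO] using hi)
    exact Finset.mem_range.mpr (by omega)
  have hcard := Finset.card_image_of_injOn hinj'
  have hup := Finset.card_le_card himg
  rw [Finset.card_range] at hup
  have heq := Finset.eq_of_subset_of_card_le himg (by rw [Finset.card_range]; omega)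
  refine ⟨fun p hp => ?_, fun i => ?_⟩
  · have : p ∈ O.image N := by rw [heq]; exact Finset.mem_range.mpr (by omega)
    obtain ⟨i, hi, h⟩ := Finset.mem_image.mp this
    exact ⟨i, by simpa [hO] using hi, h⟩
  · have := (Finset.sum_eq_sum_iff_of_le fun i (_ : i ∈ Finset.univ) => hle i).mp (by omega) i
      (Finset.mem_univ i)
    split_ifs at this <;> omega

theorem mem_drop_take_succ {ι : Type*} {K : List ι} {p : ℕ} (hp : p < K.length) {M : ι}
    (h : M ∈ (K.take (p + 1)).drop p) : M = K[p] := by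
  obtain ⟨k, hk, rfl⟩ := List.mem_iff_getElem.mp h
  simp only [List.length_drop, List.length_take] at hk
  simp only [List.getElem_drop, List.getElem_take]
  congr 1
  omega

/-- a ≤ 2n−1 STM move sequence making every face monochromatic yields a
Hamiltonian path through the bitstrings. -/
theorem stmt_16 (n m : ℕ) (hn : 0 < n) (hm : 0 < m) (l : Fin n → Fin m → Bool)
    (hdist : Function.Injective l)
    (hlast : l ⟨n - 1, by omega⟩ = fun _ => false)
    (k' : ℕ) (hk : k' ≤ 2 * n - 1) (g : Fin k' → Equiv.Perm (S (hC n m)))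
    (hSTM : ∀ q, IsSTM (g q))
    (hmono : ∀ d : Dir, ∃ d₀ : Dir, ∀ p : S (hC n m), IsSurface p → p.2 = d →
      (((List.ofFn g).reverse.prod * t hn l)⁻¹ p).2 = d₀) :
    ∃ σ : Equiv.Perm (Fin n), ∀ (p : ℕ) (hp : p + 1 < n),
      hammingDist (l (σ ⟨p, by omega⟩)) (l (σ ⟨p + 1, hp⟩)) = 1 := by
  obtain ⟨L, u, hL, H⟩ := exists_solution hn l hk g hSTM hmono
  set K := L.filter (offRow n m) with hKdef
  have hsum := sum_length_filter_inRow (n := n) (m := m) L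
  rw [hL, ← hKdef] at hsum
  have hpos : ∀ M ∈ K, M.idx ≠ 0 := fun M hM => (H.offRow_idx ⟨0, hn⟩ hM).2.1
  have hN : ∀ i : Fin n, ∃ N δ, (L.filter (inRow i m)).length = 1 →
      N ≤ K.length ∧ Crosses l (bitAt (l ⟨0, hn⟩)) K i N δ := fun i => by
    by_cases c : (L.filter (inRow i m)).length = 1
    · obtain ⟨N, δ, h⟩ := H.exists_crosses i c
      exact ⟨N, δ, fun _ => h⟩
    · exact ⟨0, .xp, fun h => absurd h c⟩
  choose N δ hN using hN
  have hinj : ∀ i i', (L.filter (inRow i m)).length = 1 → (L.filter (inRow i' m)).length = 1 →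
      N i = N i' → i = i' := fun i i' hi hi' e => hdist (funext fun j =>
    (hN i hi).2.eq_of_not_mem hpos (hN i' hi').2 e.le (by omega) fun M hM => by
      rw [e, List.drop_take, Nat.sub_self] at hM
      simp at hM)
  obtain ⟨hcov, hone⟩ := eq_one_or_eq_two hn (fun i => (L.filter (inRow i m)).length) N
    (fun i h => H.filter_inRow_ne_nil i (List.length_eq_zero_iff.mp h)) (κ := K.length) (by omega)
    (fun i hi => (hN i hi).1) hinj
  have hadj : ∀ i i' p, (hp : p < K.length) → (L.filter (inRow i m)).length = 1 →
      (L.filter (inRow i' m)).length = 1 → N i = p → N i' = p + 1 →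
      ∀ j : Fin m, l i j ≠ l i' j → K[p].idx = j + 1 := fun i i' p hp hi hi' h h' j hj => by
    by_contra c
    refine hj ((hN i hi).2.eq_of_not_mem hpos (hN i' hi').2 (by omega) (by omega) fun M hM => ?_)
    rw [h, h'] at hM
    rwa [mem_drop_take_succ hp hM]
  have hle : ∀ M ∈ K, M.idx ≤ m := fun M hM => by
    obtain ⟨p, hp, rfl⟩ := List.mem_iff_getElem.mp hM
    obtain ⟨i, hi, h⟩ := hcov p hp.le
    obtain ⟨i', hi', h'⟩ := hcov (p + 1) hp
    have hii : l i ≠ l i' := fun e => by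
      rw [hdist e] at h
      omega
    obtain ⟨j, hj⟩ := Function.ne_iff.mp hii
    have := hadj i i' p hp hi hi' h h' j hj
    have := j.2
    omega
  have hall : ∀ i : Fin n, (L.filter (inRow i m)).length = 1 := fun i =>
    (hone i).resolve_right (H.length_filter_inRow_ne_two hle hdist (fun p hp => by
      obtain ⟨i, hi, rfl⟩ := hcov p hp
      exact ⟨i, δ i, hi, (hN i hi).2⟩) i)
  have hcard : n ≤ K.length + 1 := by
    have := Fintype.card_le_of_injective
      (fun i => (⟨N i, Nat.lt_succ_of_le (hN i (hall i)).1⟩ : Fin (K.length + 1)))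
      fun i i' h => hinj i i' (hall i) (hall i') (congrArg Fin.val h)
    simpa using this
  have hs : ∀ p : Fin n, ∃ i, N i = p := fun p => by
    obtain ⟨i, -, h⟩ := hcov p (by omega)
    exact ⟨i, h⟩
  choose s hs using hs
  have hsinj : Function.Injective s := fun p p' h => Fin.ext (by rw [← hs, ← hs, h])
  refine ⟨.ofBijective s (Finite.injective_iff_bijective.mp hsinj), fun p hp => ?_⟩
  rw [Equiv.ofBijective_apply, Equiv.ofBijective_apply]
  have hpK : p < K.length := by omega
  have key := hadj (s ⟨p, by omega⟩) (s ⟨p + 1, hp⟩) p hpK (hall _) (hall _) (hs _) (hs _)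
  refine le_antisymm ?_ (hammingDist_pos.mpr fun e => ?_)
  · refine Finset.card_le_one.mpr fun j hj j' hj' => Fin.ext ?_
    have := key j (Finset.mem_filter.mp hj).2
    have := key j' (Finset.mem_filter.mp hj').2
    omega
  · have := congrArg Fin.val (hsinj (hdist e))
    simp at this

end RC
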